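/- arXiv:2203.08466 — 2 statements merged into one kernel-verified Lean document; each statement's English description precedes it below -/
import Mathlib

section
/- Let (G,X) be a flow, where G is a finitely generated group (with finite symmetric generating set Γ containing e) and X is a zero-dimensional compact metric space. Then the following conditions are pairwise equivalent: (i) every point of X is AGW-recurrent; (ii) every point of X is almost periodic; (iii) the orbit closure relation R_o = {(x,y) : y ∈ cl(Gx)} is closed in X × X. -/
/-!
STATEMENT 12. Let (G,X) be a flow with `G` a finitely generated (discrete) group with
finite symmetric generating set `Γ` containing `e`, and `X` a zero-dimensional compact
metric space.  Then the following are equivalent: (i) every point is AGW-recurrent;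
(ii) every point is almost periodic; (iii) the orbit closure relation is closed.
-/

universe u

open Pointwise MulAction

/-- The `Γ`-length of `g` : the least `r ≥ 1` with `g ∈ Γ^r`. -/
noncomputable def gamLen {G : Type u} [Group G] (Γ : Set G) (g : G) : ℕ :=
  sInf {r : ℕ | 0 < r ∧ g ∈ Γ ^ r}

/-- `K(g) = Γ^{|g|-1} · g`. -/
noncomputable def KSet {G : Type u} [Group G] (Γ : Set G) (g : G) : Set G :=
  Γ ^ (gamLen Γ g - 1) * {g}

/-- `B_r = {g ∈ G | g ≠ e, |g| ≤ r}`. -/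
noncomputable def BSet {G : Type u} [Group G] (Γ : Set G) (r : ℕ) : Set G :=
  {g : G | g ≠ 1 ∧ gamLen Γ g ≤ r}

/-- `Γ` is a finite generating set of the discrete group `G`. -/
def IsFinGenSet {G : Type u} [Group G] (Γ : Set G) : Prop :=
  Γ.Finite ∧ (1 : G) ∈ Γ ∧ Γ⁻¹ = Γ ∧ ∀ g : G, ∃ r : ℕ, 1 ≤ r ∧ g ∈ Γ ^ r

/-- `C` is an AGW-cone. -/
def IsAGWCone {G : Type u} [Group G] (Γ : Set G) (C : Set G) : Prop :=
  ∃ g : ℕ → G,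
    (∀ n : ℕ, ∃ N : ℕ, ∀ m : ℕ, N ≤ m → n ≤ gamLen Γ (g m)) ∧
    (∀ r : ℕ, 1 ≤ r → ∃ N : ℕ, ∀ m m' : ℕ, N ≤ m → N ≤ m' →
      BSet Γ r ∩ KSet Γ (g m) = BSet Γ r ∩ KSet Γ (g m')) ∧
    C = {c : G | ∃ N : ℕ, ∀ m : ℕ, N ≤ m → c ∈ KSet Γ (g m)}

/-- `x` is AGW-recurrent. -/
def AGWRecurrent {G X : Type u} [Group G] [TopologicalSpace X] [MulAction G X]
    (Γ : Set G) (x : X) : Prop :=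
  ∀ C : Set G, IsAGWCone Γ C → ∀ U ∈ nhds x, ∃ c ∈ C, c • x ∈ U

/-- `A` is syndetic in the discrete group `G` : `G = FA` for some finite `F ⊆ G`. -/
def DSyndetic {G : Type u} [Group G] (A : Set G) : Prop :=
  ∃ F : Set G, F.Finite ∧ F * A = Set.univ

/-- `x` is an almost periodic point. -/
def IsAPpt (G : Type u) {X : Type u} [Group G] [TopologicalSpace X]
    [MulAction G X] (x : X) : Prop :=
  ∀ U ∈ nhds x, DSyndetic {t : G | t • x ∈ U}

section WordLength

variable {G : Type u} [Group G] {Γ : Set G}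

theorem IsFinGenSet.pow_mono (hΓ : IsFinGenSet Γ) {m n : ℕ} (h : m ≤ n) : Γ ^ m ⊆ Γ ^ n :=
  Set.pow_subset_pow_right hΓ.2.1 h

theorem IsFinGenSet.finite_pow (hΓ : IsFinGenSet Γ) (n : ℕ) : (Γ ^ n).Finite := by
  induction n with
  | zero => simp
  | succ n ih => rw [pow_succ]; exact ih.mul hΓ.1

theorem IsFinGenSet.inv_mem_pow (hΓ : IsFinGenSet Γ) {n : ℕ} {g : G} (h : g ∈ Γ ^ n) :
    g⁻¹ ∈ Γ ^ n := by
  have h' : g⁻¹ ∈ (Γ ^ n)⁻¹ := Set.inv_mem_inv.2 h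
  rwa [← inv_pow, hΓ.2.2.1] at h'

theorem IsFinGenSet.gamLen_spec (hΓ : IsFinGenSet Γ) (g : G) :
    0 < gamLen Γ g ∧ g ∈ Γ ^ gamLen Γ g :=
  Nat.sInf_mem (s := {r : ℕ | 0 < r ∧ g ∈ Γ ^ r}) (hΓ.2.2.2 g)

theorem gamLen_le {g : G} {r : ℕ} (hr : 0 < r) (h : g ∈ Γ ^ r) : gamLen Γ g ≤ r :=
  Nat.sInf_le ⟨hr, h⟩

theorem IsFinGenSet.gamLen_inv (hΓ : IsFinGenSet Γ) (g : G) : gamLen Γ g⁻¹ = gamLen Γ g := by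
  unfold gamLen
  congr 1
  ext r
  exact and_congr_right fun _ =>
    ⟨fun h => by simpa using hΓ.inv_mem_pow h, fun h => hΓ.inv_mem_pow h⟩

theorem IsFinGenSet.finite_BSet (hΓ : IsFinGenSet Γ) (r : ℕ) : (BSet Γ r).Finite :=
  (hΓ.finite_pow r).subset fun g hg => hΓ.pow_mono hg.2 (hΓ.gamLen_spec g).2

theorem IsFinGenSet.countable (hΓ : IsFinGenSet Γ) : Countable G := by
  rw [← Set.countable_univ_iff]
  refine (Set.countable_iUnion fun n => (hΓ.finite_pow n).countable).mono fun g _ => ?_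
  exact Set.mem_iUnion.2 ⟨gamLen Γ g, (hΓ.gamLen_spec g).2⟩

theorem IsFinGenSet.exists_subset_pow (hΓ : IsFinGenSet Γ) {F : Set G} (hF : F.Finite) :
    ∃ k, 1 ≤ k ∧ F ⊆ Γ ^ k := by
  obtain ⟨M, hM⟩ := (hF.image (gamLen Γ)).bddAbove
  exact ⟨M + 1, by omega, fun f hf =>
    hΓ.pow_mono ((hM (Set.mem_image_of_mem _ hf)).trans M.le_succ) (hΓ.gamLen_spec f).2⟩

theorem mem_KSet {g c : G} : c ∈ KSet Γ g ↔ c * g⁻¹ ∈ Γ ^ (gamLen Γ g - 1) := by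
  simp [KSet]

theorem IsFinGenSet.one_notMem_KSet (hΓ : IsFinGenSet Γ) {g : G} (hg : 2 ≤ gamLen Γ g) :
    (1 : G) ∉ KSet Γ g := by
  rw [mem_KSet, one_mul]
  intro h
  have := gamLen_le (by omega) h
  rw [hΓ.gamLen_inv] at this
  omega

theorem IsFinGenSet.exists_translate_subset_KSet (hΓ : IsFinGenSet Γ) {g : G} {k : ℕ}
    (hg : k + 1 ≤ gamLen Γ g) : ∃ h ∈ Γ ^ (k + 1), ∀ a ∈ Γ ^ k, a * h ∈ KSet Γ g := by
  have hmem := (hΓ.gamLen_spec g).2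
  rw [← Nat.sub_add_cancel hg, pow_add] at hmem
  obtain ⟨b, hb, h, hh, hbh⟩ := Set.mem_mul.1 hmem
  refine ⟨h, hh, fun a ha => ?_⟩
  rw [mem_KSet, show gamLen Γ g - 1 = k + (gamLen Γ g - (k + 1)) by omega, pow_add]
  refine Set.mem_mul.2 ⟨a, ha, b⁻¹, hΓ.inv_mem_pow hb, ?_⟩
  rw [← hbh]
  group

/-- AGW-cones contain right translates of arbitrarily large balls. -/
theorem IsAGWCone.exists_translate_subset (hΓ : IsFinGenSet Γ) {C : Set G}
    (hC : IsAGWCone Γ C) {k : ℕ} (hk : 1 ≤ k) : ∃ h : G, ∀ a ∈ Γ ^ k, a * h ∈ C := by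
  obtain ⟨g, hlen, hconv, rfl⟩ := hC
  obtain ⟨N₁, hN₁⟩ := hlen (k + 1)
  obtain ⟨N₂, hN₂⟩ := hconv (k + (k + 1)) (by omega)
  have hlong := hN₁ (max N₁ N₂) (le_max_left _ _)
  obtain ⟨h, hh, hsub⟩ := hΓ.exists_translate_subset_KSet hlong
  refine ⟨h, fun a ha => ⟨max N₁ N₂, fun m hm => ?_⟩⟩
  have hK := hsub a ha
  have hB : a * h ∈ BSet Γ (k + (k + 1)) := by
    refine ⟨fun h1 => hΓ.one_notMem_KSet (by omega) (h1 ▸ hK), gamLen_le (by omega) ?_⟩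
    rw [pow_add]
    exact Set.mul_mem_mul ha hh
  have heq := hN₂ (max N₁ N₂) m (le_max_right _ _) ((le_max_right _ _).trans hm)
  exact (heq.subset ⟨hB, hK⟩).2

end WordLength

section Recurrence

open Filter Topology

variable {G X : Type u} [Group G] {Γ : Set G} [MulAction G X]

/-- If `V` is reached from `p`, but not by elements of `Γ ^ n`, then some `z ∈ V` has long
`g` with `KSet Γ g` taking `z` out of `V`. -/
theorem IsFinGenSet.exists_KSet_disjoint (hΓ : IsFinGenSet Γ) {V : Set X} {p : X} {n : ℕ}
    (hV : ∃ g : G, g • p ∈ V) (hn : ∀ g ∈ Γ ^ n, g • p ∉ V) :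
    ∃ z ∈ V, ∃ g : G, n ≤ gamLen Γ g ∧ ∀ c ∈ KSet Γ g, c • z ∉ V := by
  classical
  have hex : ∃ d, ∃ g ∈ Γ ^ d, g • p ∈ V := by
    obtain ⟨g, hg⟩ := hV
    exact ⟨_, g, (hΓ.gamLen_spec g).2, hg⟩
  obtain ⟨g, hg, hgV⟩ := Nat.find_spec hex
  have hnd : n < Nat.find hex := by
    by_contra! hle
    exact hn g (hΓ.pow_mono hle hg) hgV
  have hlen : gamLen Γ g = Nat.find hex :=
    (gamLen_le (by omega) hg).antisymm (Nat.find_min' hex ⟨g, (hΓ.gamLen_spec g).2, hgV⟩)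
  refine ⟨g • p, hgV, g⁻¹, by rw [hΓ.gamLen_inv]; omega, fun c hc hcV => ?_⟩
  rw [mem_KSet, inv_inv, hΓ.gamLen_inv, hlen] at hc
  exact Nat.find_min hex (m := Nat.find hex - 1) (by omega)
    ⟨c * g, hc, by rwa [mul_smul]⟩

theorem IsFinGenSet.isAGWCone_of_tendsto (hΓ : IsFinGenSet Γ) {g : ℕ → G} {χ : G → Prop}
    (hlen : Tendsto (fun n => gamLen Γ (g n)) atTop atTop)
    (hχ : ∀ c, ∀ᶠ n in atTop, (c ∈ KSet Γ (g n) ↔ χ c)) : IsAGWCone Γ {c | χ c} := by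
  refine ⟨g, fun n => eventually_atTop.1 (hlen.eventually_ge_atTop n), fun r _ => ?_, ?_⟩
  · obtain ⟨N, hN⟩ := eventually_atTop.1
      ((eventually_all_finite (hΓ.finite_BSet r)).2 fun c _ => hχ c)
    refine ⟨N, fun m m' hm hm' => Set.ext fun c => and_congr_right fun hc => ?_⟩
    rw [hN m hm c hc, hN m' hm' c hc]
  · ext c
    simp only [Set.mem_ofPred_eq, ← eventually_atTop]
    refine ⟨fun h => (hχ c).mono fun n hn => hn.2 h, fun h => ?_⟩
    obtain ⟨n, h1, h2⟩ := (h.and (hχ c)).exists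
    exact h2.1 h1

theorem IsFinGenSet.AGWRecurrent_of_isAPpt [TopologicalSpace X] (hΓ : IsFinGenSet Γ) {x : X}
    (hx : IsAPpt G x) : AGWRecurrent Γ x := by
  intro C hC U hU
  obtain ⟨F, hF, hFN⟩ := hx U hU
  obtain ⟨k, hk, hFk⟩ := hΓ.exists_subset_pow hF
  obtain ⟨h, hh⟩ := hC.exists_translate_subset hΓ hk
  obtain ⟨f, hf, s, hs, rfl⟩ := Set.mem_mul.1 (hFN.symm ▸ Set.mem_univ h)
  refine ⟨s, ?_, hs⟩
  simpa using hh f⁻¹ (hΓ.inv_mem_pow (hFk hf))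

variable [MetricSpace X] [CompactSpace X]

/-- If the orbits of some points `p n` meet a clopen set `V`, but only along group elements whose
lengths tend to infinity, then some point of `V` is not AGW-recurrent. -/
theorem IsFinGenSet.exists_not_AGWRecurrent (hΓ : IsFinGenSet Γ)
    (hc : ∀ g : G, Continuous fun y : X => g • y) {V : Set X} (hV : IsClopen V) {p : ℕ → X}
    (hp : ∀ n, ∃ g : G, g • p n ∈ V) (hpn : ∀ n, ∀ g ∈ Γ ^ n, g • p n ∉ V) :
    ∃ z ∈ V, ¬ AGWRecurrent Γ z := by
  classical
  have := hΓ.countable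
  choose z hzV g hlen hdisj using fun n => hΓ.exists_KSet_disjoint (hp n) (hpn n)
  obtain ⟨⟨w, χ⟩, φ, hφ, hlim⟩ := CompactSpace.tendsto_subseq
    (fun n => (z n, fun c : G => decide (c ∈ KSet Γ (g n))))
  rw [Prod.tendsto_iff] at hlim
  obtain ⟨hw, hχ⟩ := hlim
  rw [tendsto_pi_nhds] at hχ
  have hχ' : ∀ c, ∀ᶠ n in atTop, (c ∈ KSet Γ (g (φ n)) ↔ χ c = true) := fun c => by
    have h := hχ c
    rw [nhds_discrete, tendsto_pure] at h
    filter_upwards [h] with n hn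
    simp [← hn]
  have hwV : w ∈ V := hV.1.mem_of_tendsto hw (Eventually.of_forall fun n => hzV _)
  refine ⟨w, hwV, fun hrec => ?_⟩
  have hlen' : Tendsto (fun n => gamLen Γ (g (φ n))) atTop atTop :=
    tendsto_atTop_mono (fun n => hlen (φ n)) hφ.tendsto_atTop
  obtain ⟨c, hcC, hcV⟩ := hrec _ (hΓ.isAGWCone_of_tendsto hlen' hχ') V (hV.2.mem_nhds hwV)
  have hcw : Tendsto (fun n => c • z (φ n)) atTop (𝓝 (c • w)) := ((hc c).tendsto w).comp hw
  obtain ⟨n, hn, hn'⟩ := ((hcw.eventually (hV.2.mem_nhds hcV)).and (hχ' c)).exists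
  exact hdisj (φ n) c (hn'.2 hcC) hn

theorem IsFinGenSet.isClosed_orbitClosure_of_AGWRecurrent (hΓ : IsFinGenSet Γ)
    (hzero : TopologicalSpace.IsTopologicalBasis {s : Set X | IsClopen s})
    (hc : ∀ g : G, Continuous fun y : X => g • y) (hrec : ∀ x : X, AGWRecurrent Γ x) :
    IsClosed {p : X × X | p.2 ∈ closure (orbit G p.1)} := by
  rw [← isSeqClosed_iff_isClosed]
  rintro q ⟨x, y⟩ hq hlim
  rw [Prod.tendsto_iff] at hlim
  obtain ⟨hx, hy⟩ := hlim
  by_contra hxy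
  obtain ⟨V, hV, hyV, hVsub⟩ := hzero.exists_subset_of_mem_open (a := y)
    (u := (closure (orbit G x))ᶜ) hxy isClosed_closure.isOpen_compl
  have hV : IsClopen V := hV
  have hfar : ∀ n, ∃ p : X, (∃ g : G, g • p ∈ V) ∧ ∀ g ∈ Γ ^ n, g • p ∉ V := fun n => by
    have h1 : ∀ᶠ m in atTop, ∀ g ∈ Γ ^ n, g • (q m).1 ∉ V := by
      refine (eventually_all_finite (hΓ.finite_pow n)).2 fun g _ => ?_
      have hgx : g • x ∈ Vᶜ := fun h => hVsub h (subset_closure (mem_orbit x g))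
      exact (((hc g).tendsto x).comp hx).eventually (hV.1.isOpen_compl.mem_nhds hgx)
    obtain ⟨m, hm1, hm2⟩ := (h1.and (hy.eventually (hV.2.mem_nhds hyV))).exists
    obtain ⟨_, hV', g, rfl⟩ := mem_closure_iff.1 (hq m) V hV.2 hm2
    exact ⟨(q m).1, ⟨g, hV'⟩, hm1⟩
  choose p hp hpn using hfar
  obtain ⟨z, -, hz⟩ := hΓ.exists_not_AGWRecurrent hc hV hp hpn
  exact hz (hrec z)

theorem isAPpt_of_isClosed_orbitClosure (hc : ∀ g : G, Continuous fun y : X => g • y)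
    (hR : IsClosed {p : X × X | p.2 ∈ closure (orbit G p.1)}) (x : X) : IsAPpt G x := by
  intro U hU
  obtain ⟨O, hOU, hO, hxO⟩ := mem_nhds_iff.1 hU
  have hsymm : closure (orbit G x) ⊆ {y | x ∈ closure (orbit G y)} := by
    refine closure_minimal (fun y hy => subset_closure (mem_orbit_symm.1 hy)) ?_
    exact hR.preimage (f := fun y : X => (y, x)) (by fun_prop)
  obtain ⟨t, ht⟩ := (isClosed_closure (s := orbit G x)).isCompact.elim_finite_subcover
    (fun g : G => (fun y : X => g • y) ⁻¹' O) (fun g => hO.preimage (hc g)) fun y hy => by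
      obtain ⟨_, hO', g, rfl⟩ := mem_closure_iff.1 (hsymm hy) O hO hxO
      exact Set.mem_iUnion.2 ⟨g, hO'⟩
  refine ⟨(t : Set G)⁻¹, t.finite_toSet.inv, Set.eq_univ_of_forall fun s => ?_⟩
  obtain ⟨g, hg, hgO⟩ := Set.mem_iUnion₂.1 (ht (subset_closure (mem_orbit x s)))
  refine Set.mem_mul.2 ⟨g⁻¹, Set.inv_mem_inv.2 hg, g * s, hOU ?_, inv_mul_cancel_left g s⟩
  rw [mul_smul]
  exact hgO

end Recurrence

theorem stmt_12 {G X : Type u}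
    [Group G]
    [MetricSpace X] [CompactSpace X]
    (hzero : TopologicalSpace.IsTopologicalBasis {s : Set X | IsClopen s})
    [MulAction G X] (hc : ∀ g : G, Continuous fun y : X => g • y)
    (Γ : Set G) (hΓ : IsFinGenSet Γ) :
    List.TFAE
      [∀ x : X, AGWRecurrent Γ x,
       ∀ x : X, IsAPpt G x,
       IsClosed {p : X × X | p.2 ∈ closure (orbit G p.1)}] := by
  tfae_have 1 → 3 := hΓ.isClosed_orbitClosure_of_AGWRecurrent hzero hc
  tfae_have 3 → 2 := isAPpt_of_isClosed_orbitClosure hc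
  tfae_have 2 → 1 := fun h x => hΓ.AGWRecurrent_of_isAPpt (h x)
  tfae_finish
end

section
/- Let X be a zero-dimensional locally compact Hausdorff space and let G = ⟨S⟩ be an equicontinuously generated group of homeomorphisms of X with generating set S, such that cl(Gx) is compact for every x ∈ X. Then the following are pairwise equivalent: (i) every point of X is S-recurrent of type II; (ii) every point of X is almost periodic; (iii) for every compact open subset V of X, the set V_G^* = {x ∈ X : cl(Gx) ⊆ V} is open; (iv) the orbit closure relation R_o = {(x,y) : y ∈ cl(Gx)} is closed in X × X; (v) there exists a continuous surjection ρ: X → Y onto a locally compact zero-dimensional Hausdorff space Y such that ρ(gx) = ρ(x) for all g ∈ G and x ∈ X, and ρ⁻¹(y) is a minimal subset of (G,X) for each y ∈ Y. -/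
/-!
STATEMENT 19. Let `X` be a zero-dimensional locally compact Hausdorff space and
`G = ⟨S⟩` an equicontinuously generated group of homeomorphisms of `X` with compact orbit
closures.  Then the following are equivalent: (i) every point is `S`-recurrent of
type II; (ii) every point is almost periodic; (iii) `V_G^*` is open for every compact
open `V`; (iv) the orbit closure relation is closed; (v) there is a continuous invariant
surjection onto a locally compact zero-dimensional Hausdorff space whose fibers are the
minimal sets.
-/

universe u

open scoped UniformConvergence Pointwise

variable (X : Type u) [UniformSpace X]

/-- The group of self-homeomorphisms of `X` under composition (`f * g = f ∘ g`). -/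
instance : Group (X ≃ₜ X) where
  one := Homeomorph.refl X
  mul f g := g.trans f
  inv := Homeomorph.symm
  mul_assoc f g h := by ext x; rfl
  one_mul f := by ext x; rfl
  mul_one f := by ext x; rfl
  inv_mul_cancel f := by ext x; exact f.symm_apply_apply x

/-- The tautological action of `Homeo(X)` on `X`. -/
instance : MulAction (X ≃ₜ X) X where
  smul h x := h x
  one_smul _ := rfl
  mul_smul _ _ _ := rfl

/-- `Homeo(X)` as a subspace of `C_u(X,X)`: the topology of uniform convergence. -/
noncomputable instance : TopologicalSpace (X ≃ₜ X) :=
  TopologicalSpace.induced (fun h : X ≃ₜ X => UniformFun.ofFun (h : X → X)) inferInstance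

variable {X}

/-- `⟨T⟩ = ⋃_{r ≥ 1} T^r`, the group generated by a symmetric set `T` of homeomorphisms
containing the identity. -/
def GSet (T : Set (X ≃ₜ X)) : Set (X ≃ₜ X) :=
  {g | ∃ r : ℕ, 1 ≤ r ∧ g ∈ T ^ r}

/-- The `T`-length of `g` : the least `r ≥ 1` with `g ∈ T^r`. -/
noncomputable def tLen (T : Set (X ≃ₜ X)) (g : X ≃ₜ X) : ℕ :=
  sInf {r : ℕ | 0 < r ∧ g ∈ T ^ r}

/-- The orbit `⟨T⟩x = Gx`. -/
def orbT (T : Set (X ≃ₜ X)) (x : X) : Set X :=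
  {y : X | ∃ g ∈ GSet T, y = g • x}

/-- `x` is `S`-recurrent of type II under `(⟨S⟩,X)`. -/
def SRecII (S : Set (X ≃ₜ X)) (x : X) : Prop :=
  ∀ U ∈ nhds x, ∀ (ι : Type u) [Preorder ι] [Nonempty ι] [IsDirected ι (· ≤ ·)],
    ∀ g : ι → X ≃ₜ X, (∀ i, g i ∈ GSet S) →
      (∀ n : ℕ, ∃ i₀, ∀ i, i₀ ≤ i → n ≤ tLen S (g i)) →
      ∃ n : ℕ, 1 ≤ n ∧
        ∃ (κ : Type u) (pk : Preorder κ), Nonempty κ ∧ IsDirected κ pk.le ∧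
          ∃ (φ : κ → ι) (c : κ → X ≃ₜ X),
            (∀ i, ∃ k₀, ∀ k, pk.le k₀ k → i ≤ φ k) ∧
            (∀ k, c k ∈ S ^ (tLen S (g (φ k)) - 1) * {g (φ k)} ∧
              c k • x ∈ U ∧ tLen S (c k) ≤ n)

/-- `A` is a syndetic subset of the group `G = ⟨S⟩` : `G = KA` for some compact
`K ⊆ G` (compact in the topology of uniform convergence). -/
def SyndeticIn (Gs A : Set (X ≃ₜ X)) : Prop :=
  ∃ K : Set (X ≃ₜ X), K ⊆ Gs ∧ IsCompact K ∧
    ∀ g ∈ Gs, ∃ k ∈ K, ∃ a ∈ A, g = k * a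

/-- `x` is an almost periodic point of `(⟨S⟩,X)`. -/
def IsAPptT (S : Set (X ≃ₜ X)) (x : X) : Prop :=
  ∀ U ∈ nhds x, SyndeticIn (GSet S) {t : X ≃ₜ X | t ∈ GSet S ∧ t • x ∈ U}

/-- `K` is a minimal set of `(⟨S⟩,X)` : `cl(Gx) = K` for every `x ∈ K`. -/
def IsMinimalSetT (S : Set (X ≃ₜ X)) (K : Set X) : Prop :=
  ∀ x ∈ K, closure (orbT S x) = K

section GeneratedGroup

variable {S : Set (X ≃ₜ X)}

lemma homeomorph_mul_smul (g h : X ≃ₜ X) (x : X) : (g * h) • x = g • h • x := rfl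

lemma homeomorph_inv_smul_smul (g : X ≃ₜ X) (x : X) : g⁻¹ • g • x = x :=
  g.symm_apply_apply x

lemma continuous_homeomorph_smul (g : X ≃ₜ X) : Continuous fun x : X => g • x :=
  g.continuous

lemma pow_subset_pow_of_one_mem (hid : (1 : X ≃ₜ X) ∈ S) {m n : ℕ} (h : m ≤ n) :
    S ^ m ⊆ S ^ n :=
  Set.pow_subset_pow_right hid h

lemma mem_GSet_of_mem_pow (hid : (1 : X ≃ₜ X) ∈ S) {n : ℕ} {g : X ≃ₜ X} (h : g ∈ S ^ n) :
    g ∈ GSet S :=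
  ⟨n + 1, by omega, pow_subset_pow_of_one_mem hid n.le_succ h⟩

lemma one_mem_GSet (hid : (1 : X ≃ₜ X) ∈ S) : (1 : X ≃ₜ X) ∈ GSet S :=
  ⟨1, le_rfl, by simpa using hid⟩

lemma mul_mem_GSet {g h : X ≃ₜ X} (hg : g ∈ GSet S) (hh : h ∈ GSet S) : g * h ∈ GSet S := by
  obtain ⟨m, hm, hg⟩ := hg
  obtain ⟨n, hn, hh⟩ := hh
  exact ⟨m + n, by omega, by rw [pow_add]; exact Set.mul_mem_mul hg hh⟩

lemma inv_mem_pow (hsymm : ∀ h ∈ S, h⁻¹ ∈ S) {n : ℕ} {g : X ≃ₜ X} (h : g ∈ S ^ n) :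
    g⁻¹ ∈ S ^ n := by
  induction n generalizing g with
  | zero =>
    rw [pow_zero, Set.mem_one] at *
    rw [h, inv_one]
  | succ n ih =>
    rw [pow_succ] at h
    obtain ⟨a, ha, b, hb, rfl⟩ := h
    rw [pow_succ']
    exact ⟨b⁻¹, hsymm b hb, a⁻¹, ih ha, (mul_inv_rev a b).symm⟩

lemma inv_mem_GSet (hsymm : ∀ h ∈ S, h⁻¹ ∈ S) {g : X ≃ₜ X} (h : g ∈ GSet S) :
    g⁻¹ ∈ GSet S := by
  obtain ⟨n, hn, h⟩ := h
  exact ⟨n, hn, inv_mem_pow hsymm h⟩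

lemma mem_pow_tLen {g : X ≃ₜ X} (h : g ∈ GSet S) : g ∈ S ^ tLen S g :=
  (Nat.sInf_mem (s := {r : ℕ | 0 < r ∧ g ∈ S ^ r}) h).2

lemma tLen_le {g : X ≃ₜ X} {n : ℕ} (hn : 0 < n) (h : g ∈ S ^ n) : tLen S g ≤ n :=
  Nat.sInf_le ⟨hn, h⟩

lemma tLen_inv (hsymm : ∀ h ∈ S, h⁻¹ ∈ S) (g : X ≃ₜ X) : tLen S g⁻¹ = tLen S g := by
  unfold tLen
  congr 1
  ext r
  refine and_congr_right fun _ => ⟨fun h => ?_, inv_mem_pow hsymm⟩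
  simpa using inv_mem_pow hsymm h

lemma smul_mem_orbT {g : X ≃ₜ X} (h : g ∈ GSet S) (x : X) : g • x ∈ orbT S x :=
  ⟨g, h, rfl⟩

lemma mem_orbT_self (hid : (1 : X ≃ₜ X) ∈ S) (x : X) : x ∈ orbT S x :=
  smul_mem_orbT (one_mem_GSet hid) x

lemma smul_mem_closure_orbT {g : X ≃ₜ X} (h : g ∈ GSet S) {x y : X}
    (hy : y ∈ closure (orbT S x)) : g • y ∈ closure (orbT S x) := by
  refine map_mem_closure (continuous_homeomorph_smul g) hy ?_
  rintro _ ⟨k, hk, rfl⟩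
  exact ⟨g * k, mul_mem_GSet h hk, rfl⟩

lemma closure_orbT_subset {x y : X} (hy : y ∈ closure (orbT S x)) :
    closure (orbT S y) ⊆ closure (orbT S x) := by
  refine closure_minimal ?_ isClosed_closure
  rintro _ ⟨g, hg, rfl⟩
  exact smul_mem_closure_orbT hg hy

end GeneratedGroup

section Evaluation

lemma continuous_homeomorph_eval : Continuous fun p : (X ≃ₜ X) × X => p.1 • p.2 := by
  refine continuous_iff_continuousAt.2 fun ⟨g, x⟩ => ?_
  have h : Filter.Tendsto (fun p : (X ≃ₜ X) × X => UniformFun.ofFun (p.1 : X → X))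
      (nhds (g, x)) (nhds (UniformFun.ofFun (g : X → X))) :=
    (continuous_induced_dom.comp continuous_fst).tendsto (g, x)
  exact (UniformFun.tendsto_iff_tendstoUniformly.1 h).tendsto_comp g.continuous.continuousAt
    continuous_snd.continuousAt

end Evaluation

section ZeroDimensional

lemma IsCompact.exists_isCompact_isOpen_between [T2Space X] [LocallyCompactSpace X]
    (hzero : TopologicalSpace.IsTopologicalBasis {s : Set X | IsClopen s})
    {K O : Set X} (hK : IsCompact K) (hO : IsOpen O) (h : K ⊆ O) :
    ∃ V : Set X, IsCompact V ∧ IsOpen V ∧ K ⊆ V ∧ V ⊆ O := by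
  refine hK.induction_on (p := fun s => ∃ V : Set X, IsCompact V ∧ IsOpen V ∧ s ⊆ V ∧ V ⊆ O)
    ⟨∅, isCompact_empty, isOpen_empty, subset_rfl, Set.empty_subset _⟩ ?_ ?_ ?_
  · rintro s t hst ⟨V, hV, hV', h1, h2⟩
    exact ⟨V, hV, hV', hst.trans h1, h2⟩
  · rintro s t ⟨V, hV, hV', h1, h2⟩ ⟨W, hW, hW', h3, h4⟩
    exact ⟨V ∪ W, hV.union hW, hV'.union hW', Set.union_subset_union h1 h3,
      Set.union_subset h2 h4⟩
  · intro x hx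
    obtain ⟨N, hN, hNO, hNc⟩ := local_compact_nhds (hO.mem_nhds (h hx))
    obtain ⟨V, hV, hxV, hVN⟩ := hzero.mem_nhds_iff.1 hN
    exact ⟨V, mem_nhdsWithin_of_mem_nhds (hV.2.mem_nhds hxV), V,
      hNc.of_isClosed_subset hV.1 hVN, hV.2, subset_rfl, hVN.trans hNO⟩

lemma IsCompact.eventually_mem_isClopen_iff {K V : Set X} (hK : IsCompact K)
    (hV : IsClopen V) : ∀ᶠ p : X × X in uniformity X, p.1 ∈ K → (p.1 ∈ V ↔ p.2 ∈ V) := by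
  have h := hK.uniformContinuousAt_of_continuousAt V.boolIndicator
    (fun a _ => ((continuous_boolIndicator_iff_isClopen V).2 hV).continuousAt)
    (DiscreteUniformity.relId_mem_uniformity Bool)
  filter_upwards [h] with p hp hpK
  have hp' : V.boolIndicator p.1 = V.boolIndicator p.2 := hp hpK
  rw [Set.mem_iff_boolIndicator, Set.mem_iff_boolIndicator, hp']

end ZeroDimensional

section Equicontinuity

variable {S : Set (X ≃ₜ X)}

/-- All powers `S ^ n` are equicontinuous when orbit closures are compact. -/
lemma eventually_pow_smul_mem_uniformity (hid : (1 : X ≃ₜ X) ∈ S)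
    (hequi : Equicontinuous (fun h : S => (h.1 : X → X)))
    (horb : ∀ x : X, IsCompact (closure (orbT S x))) (n : ℕ) (p : X)
    {ε : Set (X × X)} (hε : ε ∈ uniformity X) :
    ∀ᶠ q in nhds p, ∀ c ∈ S ^ n, (c • p, c • q) ∈ ε := by
  induction n generalizing ε with
  | zero =>
    filter_upwards [UniformSpace.ball_mem_nhds p hε] with q hq c hc
    rw [pow_zero, Set.mem_one] at hc
    subst hc
    exact hq
  | succ n ih =>
    have h := (horb p).uniformContinuousAt_of_continuousAt
      (fun x => UniformFun.ofFun fun s : S => (s.1 : X → X) x)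
      (fun a _ => equicontinuousAt_iff_continuousAt.1 (hequi a))
      ((UniformFun.hasBasis_uniformity S X).mem_of_mem hε)
    filter_upwards [ih h] with q hq c hc
    rw [pow_succ'] at hc
    obtain ⟨s, hs, c, hc, rfl⟩ := hc
    exact hq c hc (subset_closure (smul_mem_orbT (mem_GSet_of_mem_pow hid hc) p)) ⟨s, hs⟩

lemma eventually_pow_smul_mem_iff (hid : (1 : X ≃ₜ X) ∈ S)
    (hequi : Equicontinuous (fun h : S => (h.1 : X → X)))
    (horb : ∀ x : X, IsCompact (closure (orbT S x))) (n : ℕ) (p : X)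
    {V : Set X} (hV : IsClopen V) :
    ∀ᶠ q in nhds p, ∀ c ∈ S ^ n, (c • p ∈ V ↔ c • q ∈ V) := by
  filter_upwards [eventually_pow_smul_mem_uniformity hid hequi horb n p
    ((horb p).eventually_mem_isClopen_iff hV)] with q hq c hc
  exact hq c hc (subset_closure (smul_mem_orbT (mem_GSet_of_mem_pow hid hc) p))

end Equicontinuity

section Equivalences

variable {S : Set (X ≃ₜ X)}

/-- Every orbit closure is minimal: the orbit closure relation is symmetric. -/
def IsPointwiseMinimal (S : Set (X ≃ₜ X)) : Prop :=
  ∀ x y : X, y ∈ closure (orbT S x) → x ∈ closure (orbT S y)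

lemma IsPointwiseMinimal.closure_orbT_eq (h : IsPointwiseMinimal S) {x y : X}
    (hy : y ∈ closure (orbT S x)) : closure (orbT S y) = closure (orbT S x) :=
  (closure_orbT_subset hy).antisymm (closure_orbT_subset (h x y hy))

lemma IsPointwiseMinimal.exists_finset (h : IsPointwiseMinimal S)
    (horb : ∀ x : X, IsCompact (closure (orbT S x))) {x : X} {U : Set X} (hU : U ∈ nhds x) :
    ∃ t : Finset (X ≃ₜ X), (∀ f ∈ t, f ∈ GSet S) ∧
      ∀ z ∈ closure (orbT S x), ∃ f ∈ t, f • z ∈ U := by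
  classical
  obtain ⟨t, ht⟩ := (horb x).elim_finite_subcover
    (fun g : GSet S => (fun z : X => g.1 • z) ⁻¹' interior U)
    (fun g => isOpen_interior.preimage (continuous_homeomorph_smul g.1)) (by
      intro z hz
      obtain ⟨_, hw, g, hg, rfl⟩ := mem_closure_iff.1 (h x z hz) _ isOpen_interior
        (mem_interior_iff_mem_nhds.2 hU)
      exact Set.mem_iUnion.2 ⟨⟨g, hg⟩, hw⟩)
  refine ⟨t.image Subtype.val, ?_, fun z hz => ?_⟩
  · intro f hf
    obtain ⟨g, -, rfl⟩ := Finset.mem_image.1 hf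
    exact g.2
  · obtain ⟨g, hg, hgz⟩ := Set.mem_iUnion₂.1 (ht hz)
    exact ⟨g, Finset.mem_image_of_mem _ hg, interior_subset hgz⟩

lemma IsPointwiseMinimal.isAPptT (h : IsPointwiseMinimal S)
    (hsymm : ∀ h ∈ S, h⁻¹ ∈ S) (horb : ∀ x : X, IsCompact (closure (orbT S x))) (x : X) :
    IsAPptT S x := by
  intro U hU
  obtain ⟨t, htG, ht⟩ := h.exists_finset horb hU
  refine ⟨(fun f => f⁻¹) '' (t : Set (X ≃ₜ X)), ?_, (t.finite_toSet.image _).isCompact, ?_⟩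
  · rintro _ ⟨f, hf, rfl⟩
    exact inv_mem_GSet hsymm (htG f hf)
  · intro g hg
    obtain ⟨f, hf, hfg⟩ := ht (g • x) (subset_closure (smul_mem_orbT hg x))
    exact ⟨f⁻¹, ⟨f, hf, rfl⟩, f * g, ⟨mul_mem_GSet (htG f hf) hg, hfg⟩,
      (inv_mul_cancel_left f g).symm⟩

lemma isPointwiseMinimal_of_isAPptT [T2Space X] (hsymm : ∀ h ∈ S, h⁻¹ ∈ S)
    (horb : ∀ x : X, IsCompact (closure (orbT S x))) (h : ∀ x : X, IsAPptT S x) :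
    IsPointwiseMinimal S := by
  intro x y hy
  refine mem_closure_iff_nhds.2 fun U hU => ?_
  obtain ⟨C, hC, hCc, hCU⟩ := exists_mem_nhds_isClosed_subset hU
  obtain ⟨K, hKG, hK, hKC⟩ := h x C hC
  have hE : IsClosed ((fun p : (X ≃ₜ X) × X => p.1 • p.2) ''
      (K ×ˢ (closure (orbT S x) ∩ C))) :=
    ((hK.prod ((horb x).inter_right hCc)).image continuous_homeomorph_eval).isClosed
  have hsub : orbT S x ⊆ (fun p : (X ≃ₜ X) × X => p.1 • p.2) ''
      (K ×ˢ (closure (orbT S x) ∩ C)) := by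
    rintro _ ⟨g, hg, rfl⟩
    obtain ⟨k, hk, a, ⟨haG, haC⟩, rfl⟩ := hKC g hg
    exact ⟨(k, a • x), ⟨hk, subset_closure (smul_mem_orbT haG x), haC⟩, rfl⟩
  obtain ⟨⟨k, c⟩, ⟨hk, -, hc⟩, rfl⟩ := closure_minimal hsub hE hy
  exact ⟨c, hCU hc, k⁻¹, inv_mem_GSet hsymm (hKG hk), (homeomorph_inv_smul_smul k c).symm⟩

lemma IsPointwiseMinimal.sRecII (h : IsPointwiseMinimal S) (hid : (1 : X ≃ₜ X) ∈ S)
    (hsymm : ∀ h ∈ S, h⁻¹ ∈ S) (horb : ∀ x : X, IsCompact (closure (orbT S x))) (x : X) :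
    SRecII S x := by
  intro U hU ι _ _ _ g hg hlen
  obtain ⟨t, htG, ht⟩ := h.exists_finset horb hU
  obtain ⟨n, hn⟩ : ∃ n : ℕ, ∀ f ∈ t, f ∈ S ^ n :=
    ⟨t.sup (tLen S), fun f hf => pow_subset_pow_of_one_mem hid (Finset.le_sup hf)
      (mem_pow_tLen (htG f hf))⟩
  have key : ∀ g ∈ GSet S, n + 1 ≤ tLen S g →
      ∃ c ∈ S ^ (tLen S g - 1) * {g}, c • x ∈ U ∧ tLen S c ≤ n + (n + 1) := by
    intro g hg hlg
    have hgp := mem_pow_tLen hg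
    rw [show tLen S g = (tLen S g - (n + 1)) + (n + 1) by omega, pow_add] at hgp
    obtain ⟨b, hb, a, ha, hba⟩ := hgp
    replace hba : b * a = g := hba
    obtain ⟨f, hf, hfa⟩ := ht (a • x)
      (subset_closure (smul_mem_orbT (mem_GSet_of_mem_pow hid ha) x))
    refine ⟨f * a, ⟨f * b⁻¹, ?_, g, rfl, ?_⟩, hfa, tLen_le (by omega) ?_⟩
    · rw [show tLen S g - 1 = n + (tLen S g - (n + 1)) by omega, pow_add]
      exact Set.mul_mem_mul (hn f hf) (inv_mem_pow hsymm hb)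
    · change f * b⁻¹ * g = f * a
      rw [← hba]
      group
    · rw [pow_add]
      exact Set.mul_mem_mul (hn f hf) ha
  obtain ⟨i₀, hi₀⟩ := hlen (n + 1)
  choose! c hc hcU hcn using key
  have : Nonempty {i : ι // i₀ ≤ i} := ⟨⟨i₀, le_rfl⟩⟩
  refine ⟨n + (n + 1), by omega, {i : ι // i₀ ≤ i}, inferInstance, this, ⟨?_⟩, Subtype.val,
    fun k => c (g k), fun i => ?_, fun k => ?_⟩
  · rintro ⟨a, ha⟩ ⟨b, hb⟩
    obtain ⟨d, had, hbd⟩ := exists_ge_ge a b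
    exact ⟨⟨d, ha.trans had⟩, had, hbd⟩
  · obtain ⟨d, hid, hd⟩ := exists_ge_ge i i₀
    exact ⟨⟨d, hd⟩, fun k hk => hid.trans hk⟩
  · have hk := hi₀ k k.2
    exact ⟨hc _ (hg k) hk, hcU _ (hg k) hk, hcn _ (hg k) hk⟩

lemma isOpen_setOf_closure_orbT_subset_of_sRecII [T2Space X] (hid : (1 : X ≃ₜ X) ∈ S)
    (hsymm : ∀ h ∈ S, h⁻¹ ∈ S) (hequi : Equicontinuous (fun h : S => (h.1 : X → X)))
    (horb : ∀ x : X, IsCompact (closure (orbT S x))) (hrec : ∀ x : X, SRecII S x)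
    {V : Set X} (hVc : IsCompact V) (hVo : IsOpen V) :
    IsOpen {x : X | closure (orbT S x) ⊆ V} := by
  classical
  have hV : IsClopen V := ⟨hVc.isClosed, hVo⟩
  refine isOpen_iff_mem_nhds.2 fun x hx => ?_
  by_contra hnot
  obtain ⟨F, hFx, hFV⟩ : ∃ F : Ultrafilter X, ↑F ≤ nhds x ∧
      {x : X | closure (orbT S x) ⊆ V} ∉ F := by
    by_contra! hcon
    exact hnot (Filter.mem_iff_ultrafilter.2 hcon)
  have hxV : x ∈ V := hx (subset_closure (mem_orbT_self hid x))
  -- a shortest word leading each point out of `V`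
  have hexit : ∀ z : X, z ∈ V → ¬ closure (orbT S z) ⊆ V →
      ∃ (r : ℕ) (s h : X ≃ₜ X), s ∈ S ∧ h ∈ S ^ r ∧ (s * h) • z ∉ V ∧
        ∀ m ≤ r, ∀ w ∈ S ^ m, w • z ∈ V := by
    intro z hz hzV
    have hex : ∃ r : ℕ, ∃ g ∈ S ^ r, g • z ∉ V := by
      by_contra! hcon
      refine hzV (closure_minimal ?_ hVc.isClosed)
      rintro _ ⟨g, ⟨r, -, hg⟩, rfl⟩
      exact hcon r g hg
    obtain ⟨g, hg, hgz⟩ := Nat.find_spec hex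
    have hmin : ∀ m < Nat.find hex, ∀ w ∈ S ^ m, w • z ∈ V := fun m hm w hw => by
      by_contra hwz
      exact Nat.find_min hex hm ⟨w, hw, hwz⟩
    rcases hr : Nat.find hex with _ | r
    · rw [hr, pow_zero, Set.mem_one] at hg
      subst hg
      exact absurd hz hgz
    · rw [hr, pow_succ'] at hg
      obtain ⟨s, hs, h, hh, rfl⟩ := hg
      exact ⟨r, s, h, hs, hh, hgz, fun m hm => hmin m (by omega)⟩
  choose! r s h hs hh hout hin using hexit
  have hgood : ∀ᶠ z in (F : Filter X), z ∈ V ∧ ¬ closure (orbT S z) ⊆ V :=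
    Filter.Eventually.and (hFx (hVo.mem_nhds hxV)) (Ultrafilter.compl_mem_iff_notMem.2 hFV)
  have hpow : ∀ z, z ∈ V → ¬ closure (orbT S z) ⊆ V → s z * h z ∈ S ^ (r z + 1) :=
    fun z hz hzV => by
      rw [pow_succ']
      exact Set.mul_mem_mul (hs z hz hzV) (hh z hz hzV)
  have hlen : ∀ z, z ∈ V → ¬ closure (orbT S z) ⊆ V → tLen S (s z * h z) = r z + 1 := by
    intro z hz hzV
    refine (tLen_le (by omega) (hpow z hz hzV)).antisymm ?_
    by_contra! hlt
    exact hout z hz hzV (hin z hz hzV _ (by omega) _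
      (mem_pow_tLen (mem_GSet_of_mem_pow hid (hpow z hz hzV))))
  have hlarge : ∀ n : ℕ, ∀ᶠ z in (F : Filter X), n ≤ r z := by
    intro n
    filter_upwards [hFx (eventually_pow_smul_mem_iff hid hequi horb n x hV), hgood]
      with z hz hzg
    by_contra! hlt
    have hzp := pow_subset_pow_of_one_mem hid (show r z + 1 ≤ n by omega) (hpow z hzg.1 hzg.2)
    exact hout z hzg.1 hzg.2 ((hz _ hzp).1
      (hx (subset_closure (smul_mem_orbT (mem_GSet_of_mem_pow hid hzp) x))))
  -- the exit points converge to some `p ∉ V`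
  obtain ⟨y, -, hy⟩ := hVc.ultrafilter_le_nhds (F.map fun z => h z • z) (by
    refine Filter.le_principal_iff.2 (Filter.mem_map.2 ?_)
    filter_upwards [hgood] with z hz
    exact hin z hz.1 hz.2 _ le_rfl _ (hh z hz.1 hz.2))
  obtain ⟨p, -, hp⟩ := (horb y).ultrafilter_le_nhds (F.map fun z => s z • y) (by
    refine Filter.le_principal_iff.2 (Filter.mem_map.2 ?_)
    filter_upwards [hgood] with z hz
    exact subset_closure (smul_mem_orbT
      (mem_GSet_of_mem_pow (n := 1) hid (by simpa using hs z hz.1 hz.2)) y))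
  have hq : Filter.Tendsto (fun z => (s z * h z) • z) F (nhds p) := by
    refine Filter.Tendsto.congr_uniformity (f := fun z => s z • y) hp fun ε hε => ?_
    have hy' : Filter.Tendsto (fun z => h z • z) F (nhds y) := hy
    refine Filter.mem_map.2 ?_
    filter_upwards [hgood, hy'.eventually
      (eventually_pow_smul_mem_uniformity hid hequi horb 1 y hε)] with z hz hzε
    exact hzε _ (by simpa using hs z hz.1 hz.2)
  have hpV : p ∈ Vᶜ := hVo.isClosed_compl.mem_of_tendsto hq (by
    filter_upwards [hgood] with z hz
    exact hout z hz.1 hz.2)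
  -- the net of inverse exit words, indexed by the sets of `F` with a chosen point
  let ι := {i : Set X × X // i.1 ∈ F ∧ i.2 ∈ i.1 ∧ i.2 ∈ V ∧ ¬ closure (orbT S i.2) ⊆ V}
  let _ : Preorder ι := Preorder.lift fun i => OrderDual.toDual i.1.1
  have hι : ∀ A ∈ F, ∃ i : ι, i.1.1 = A := fun A hA => by
    obtain ⟨z, hzA, hz⟩ := F.nonempty_of_mem (Filter.inter_mem hA hgood)
    exact ⟨⟨(A, z), hA, hzA, hz⟩, rfl⟩
  have : Nonempty ι := (hι Set.univ Filter.univ_mem).nonempty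
  have : IsDirected ι (· ≤ ·) := ⟨fun i j => by
    obtain ⟨k, hk⟩ := hι (i.1.1 ∩ j.1.1) (Filter.inter_mem i.2.1 j.2.1)
    exact ⟨k, hk.trans_subset Set.inter_subset_left, hk.trans_subset Set.inter_subset_right⟩⟩
  obtain ⟨n, -, κ, pk, -, -, φ, c, hφ, hc⟩ := hrec p Vᶜ
    (hVc.isClosed.isOpen_compl.mem_nhds hpV) ι
    (fun i => (s i.1.2 * h i.1.2)⁻¹)
    (fun i => inv_mem_GSet hsymm (mem_GSet_of_mem_pow hid (hpow _ i.2.2.2.1 i.2.2.2.2)))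
    (fun n => by
      obtain ⟨i₀, hi₀⟩ := hι _ (hlarge n)
      refine ⟨i₀, fun i hi => ?_⟩
      have hni : n ≤ r i.1.2 := hi₀.subset (hi i.2.2.1)
      rw [tLen_inv hsymm, hlen _ i.2.2.2.1 i.2.2.2.2]
      omega)
  obtain ⟨i₀, hi₀⟩ := hι _ (hq.eventually (eventually_pow_smul_mem_iff hid hequi horb n p hV))
  obtain ⟨k, hk⟩ := hφ i₀
  obtain ⟨hcS, hcV, hcn⟩ := hc k
  have hki := hk k (pk.le_refl k)
  obtain ⟨-, hzA, hzV, hzO⟩ := (φ k).2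
  have hz := hi₀.subset (hki hzA)
  generalize (φ k).1.2 = z at *
  rw [tLen_inv hsymm, hlen z hzV hzO, Nat.add_sub_cancel] at hcS
  obtain ⟨w, hw, _, rfl, hwc⟩ := hcS
  replace hwc : w * (s z * h z)⁻¹ = c k := hwc
  have hcG : c k ∈ GSet S := hwc ▸ mul_mem_GSet (mem_GSet_of_mem_pow hid hw)
    (inv_mem_GSet hsymm (mem_GSet_of_mem_pow hid (hpow z hzV hzO)))
  refine hcV ((hz (c k) (pow_subset_pow_of_one_mem hid hcn (mem_pow_tLen hcG))).2 ?_)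
  rw [← hwc, ← homeomorph_mul_smul, inv_mul_cancel_right]
  exact hin z hzV hzO _ le_rfl w hw

lemma isClosed_orbit_closure_relation [T2Space X] [LocallyCompactSpace X]
    (hzero : TopologicalSpace.IsTopologicalBasis {s : Set X | IsClopen s})
    (horb : ∀ x : X, IsCompact (closure (orbT S x)))
    (hopen : ∀ V : Set X, IsCompact V → IsOpen V →
      IsOpen {x : X | closure (orbT S x) ⊆ V}) :
    IsClosed {p : X × X | p.2 ∈ closure (orbT S p.1)} := by
  refine ⟨isOpen_iff_mem_nhds.2 ?_⟩
  rintro ⟨x, y⟩ hxy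
  obtain ⟨V, hVc, hVo, hxV, hVy⟩ := (horb x).exists_isCompact_isOpen_between hzero
    isOpen_compl_singleton (Set.subset_compl_singleton_iff.2 hxy)
  filter_upwards [prod_mem_nhds ((hopen V hVc hVo).mem_nhds hxV)
    (hVc.isClosed.isOpen_compl.mem_nhds fun hy => hVy hy rfl)] with q hq hq'
  exact hq.2 (hq.1 hq')

lemma isPointwiseMinimal_of_isClosed (hsymm : ∀ h ∈ S, h⁻¹ ∈ S)
    (hR : IsClosed {p : X × X | p.2 ∈ closure (orbT S p.1)}) : IsPointwiseMinimal S := by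
  intro x y hy
  have hcl : IsClosed {z : X | x ∈ closure (orbT S z)} :=
    hR.preimage (Continuous.prodMk_left x)
  refine closure_minimal ?_ hcl hy
  rintro _ ⟨g, hg, rfl⟩
  exact subset_closure ⟨g⁻¹, inv_mem_GSet hsymm hg, (homeomorph_inv_smul_smul g x).symm⟩

/-- The orbit closure relation of a pointwise minimal action, as a setoid. -/
def IsPointwiseMinimal.setoid (h : IsPointwiseMinimal S) (hid : (1 : X ≃ₜ X) ∈ S) :
    Setoid X where
  r x y := y ∈ closure (orbT S x)
  iseqv :=
    { refl := fun x => subset_closure (mem_orbT_self hid x)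
      symm := fun {x y} hxy => h x y hxy
      trans := fun hxy hyz => closure_orbT_subset hxy hyz }

lemma IsPointwiseMinimal.mk_eq_iff (h : IsPointwiseMinimal S) (hid : (1 : X ≃ₜ X) ∈ S)
    {x y : X} : (Quotient.mk (h.setoid hid) x = Quotient.mk (h.setoid hid) y) ↔
      y ∈ closure (orbT S x) :=
  Quotient.eq

lemma IsPointwiseMinimal.isOpenMap_mk (h : IsPointwiseMinimal S) (hid : (1 : X ≃ₜ X) ∈ S) :
    IsOpenMap (Quotient.mk (h.setoid hid)) := by
  intro W hW
  have hsat : Quotient.mk (h.setoid hid) ⁻¹' (Quotient.mk (h.setoid hid) '' W) =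
      ⋃ g ∈ GSet S, (fun x : X => g • x) ⁻¹' W := by
    ext x
    simp only [Set.mem_preimage, Set.mem_image, Set.mem_iUnion, exists_prop]
    constructor
    · rintro ⟨w, hw, hwx⟩
      obtain ⟨_, hgW, g, hg, rfl⟩ :=
        mem_closure_iff.1 ((h.mk_eq_iff hid).1 hwx.symm) W hW hw
      exact ⟨g, hg, hgW⟩
    · rintro ⟨g, hg, hgW⟩
      exact ⟨g • x, hgW, ((h.mk_eq_iff hid).2 (subset_closure (smul_mem_orbT hg x))).symm⟩
  refine isQuotientMap_quotient_mk'.isOpen_preimage.1 (hsat ▸ ?_)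
  exact isOpen_biUnion fun g _ => hW.preimage (continuous_homeomorph_smul g)

lemma IsPointwiseMinimal.exists_quotient [T2Space X] [LocallyCompactSpace X]
    (h : IsPointwiseMinimal S)
    (hzero : TopologicalSpace.IsTopologicalBasis {s : Set X | IsClopen s})
    (hid : (1 : X ≃ₜ X) ∈ S)
    (hR : IsClosed {p : X × X | p.2 ∈ closure (orbT S p.1)}) :
    ∃ (Y : Type u) (ty : TopologicalSpace Y),
      @T2Space Y ty ∧ @LocallyCompactSpace Y ty ∧
      @TopologicalSpace.IsTopologicalBasis Y ty {s : Set Y | @IsClopen Y ty s} ∧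
      ∃ ρ : X → Y, @Continuous X Y _ ty ρ ∧ Function.Surjective ρ ∧
        (∀ g ∈ GSet S, ∀ x : X, ρ (g • x) = ρ x) ∧
        ∀ y : Y, IsMinimalSetT S (ρ ⁻¹' {y}) := by
  have hopen := h.isOpenMap_mk hid
  have hcont : Continuous (Quotient.mk (h.setoid hid)) := continuous_quotient_mk'
  have hsurj : Function.Surjective (Quotient.mk (h.setoid hid)) := Quotient.mk_surjective
  have hbasis : ∀ (x : X) (O : Set (Quotient (h.setoid hid))),
      O ∈ nhds (Quotient.mk (h.setoid hid) x) →
      ∃ W, IsCompact W ∧ IsOpen W ∧ Quotient.mk (h.setoid hid) x ∈ W ∧ W ⊆ O := by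
    intro x O hO
    obtain ⟨V, hVc, hVo, hxV, hVO⟩ :=
      (isCompact_singleton (x := x)).exists_isCompact_isOpen_between hzero
        (isOpen_interior.preimage hcont)
        (Set.singleton_subset_iff.2 (mem_interior_iff_mem_nhds.2 hO))
    exact ⟨_, hVc.image hcont, hopen V hVo, ⟨x, hxV rfl, rfl⟩,
      Set.image_subset_iff.2 (hVO.trans (Set.preimage_mono interior_subset))⟩
  have hT2 : T2Space (Quotient (h.setoid hid)) := by
    refine (t2Space_iff_of_isOpenQuotientMap ⟨hsurj, hcont, hopen⟩).2 ?_
    simpa only [h.mk_eq_iff hid] using hR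
  refine ⟨Quotient (h.setoid hid), inferInstance, hT2, ⟨fun q O hO => ?_⟩, ?_,
    Quotient.mk (h.setoid hid), hcont, hsurj, fun g hg x =>
      ((h.mk_eq_iff hid).2 (subset_closure (smul_mem_orbT hg x))).symm, fun q => ?_⟩
  · obtain ⟨x, rfl⟩ := hsurj q
    obtain ⟨W, hWc, hWo, hxW, hWO⟩ := hbasis x O hO
    exact ⟨W, hWo.mem_nhds hxW, hWO, hWc⟩
  · refine TopologicalSpace.isTopologicalBasis_of_isOpen_of_nhds (fun W hW => hW.2)
      fun q O hq hO => ?_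
    obtain ⟨x, rfl⟩ := hsurj q
    obtain ⟨W, hWc, hWo, hxW, hWO⟩ := hbasis x O (hO.mem_nhds hq)
    exact ⟨W, ⟨hWc.isClosed, hWo⟩, hxW, hWO⟩
  · rintro x rfl
    ext y
    exact (h.mk_eq_iff hid).symm.trans eq_comm

end Equivalences

theorem stmt_19 {X : Type u} [UniformSpace X] [T2Space X] [LocallyCompactSpace X]
    (hzero : TopologicalSpace.IsTopologicalBasis {s : Set X | IsClopen s})
    (S : Set (X ≃ₜ X))
    (hid : (1 : X ≃ₜ X) ∈ S)
    (hsymm : ∀ h ∈ S, h⁻¹ ∈ S)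
    (hequi : Equicontinuous (fun h : S => (h.1 : X → X)))
    (horb : ∀ x : X, IsCompact (closure (orbT S x))) :
    List.TFAE
      [∀ x : X, SRecII S x,
       ∀ x : X, IsAPptT S x,
       ∀ V : Set X, IsCompact V → IsOpen V → IsOpen {x : X | closure (orbT S x) ⊆ V},
       IsClosed {p : X × X | p.2 ∈ closure (orbT S p.1)},
       ∃ (Y : Type u) (ty : TopologicalSpace Y),
         @T2Space Y ty ∧ @LocallyCompactSpace Y ty ∧
         @TopologicalSpace.IsTopologicalBasis Y ty {s : Set Y | @IsClopen Y ty s} ∧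
         ∃ ρ : X → Y, @Continuous X Y _ ty ρ ∧ Function.Surjective ρ ∧
           (∀ g ∈ GSet S, ∀ x : X, ρ (g • x) = ρ x) ∧
           ∀ y : Y, IsMinimalSetT S (ρ ⁻¹' {y})] := by
  tfae_have 2 → 1 := fun h =>
    (isPointwiseMinimal_of_isAPptT hsymm horb h).sRecII hid hsymm horb
  tfae_have 1 → 3 := fun h V hVc hVo =>
    isOpen_setOf_closure_orbT_subset_of_sRecII hid hsymm hequi horb h hVc hVo
  tfae_have 3 → 4 := isClosed_orbit_closure_relation hzero horb
  tfae_have 4 → 5 := fun h =>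
    (isPointwiseMinimal_of_isClosed hsymm h).exists_quotient hzero hid h
  tfae_have 5 → 2 := by
    rintro ⟨Y, _, -, -, -, ρ, -, -, -, hmin⟩
    refine IsPointwiseMinimal.isAPptT (fun x y hy => ?_) hsymm horb
    rw [hmin (ρ x) x rfl] at hy
    rw [hmin (ρ x) y hy]
    rfl
  tfae_finish
end
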